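/- For every integer r ≥ 3 and integers n₁ ≥ n₂ ≥ ⋯ ≥ n_r ≥ 1, every edge-coloring of the complete r-partite graph K_{n₁,n₂,…,n_r} using exactly n₁ + n₂ + ⋯ + n_r + t colors contains a rainbow 4-cycle, where t = min{ ⌊(n₁+⋯+n_r)/3⌋, ⌊(n₂+⋯+n_r)/2⌋, n₃+⋯+n_r }. -/

import Mathlib

open Finset

/-- The complete `r`-partite graph with parts of sizes `n 0, n 1, …, n (r-1)`. -/
def Kpartite (r : ℕ) (n : ℕ → ℕ) : SimpleGraph ((i : Fin r) × Fin (n i)) :=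
  SimpleGraph.completeMultipartiteGraph fun i : Fin r => Fin (n i)

/-- The edge-coloring `c` contains a rainbow 3-cycle in `G`. -/
def RainbowC3 {V α : Type*} (G : SimpleGraph V) (c : Sym2 V → α) : Prop :=
  ∃ a b d : V, G.Adj a b ∧ G.Adj b d ∧ G.Adj d a ∧
    c s(a, b) ≠ c s(b, d) ∧ c s(b, d) ≠ c s(d, a) ∧ c s(a, b) ≠ c s(d, a)

/-- The edge-coloring `c` contains a rainbow 4-cycle in `G`. -/
def RainbowC4 {V α : Type*} (G : SimpleGraph V) (c : Sym2 V → α) : Prop :=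
  ∃ a b d e : V, G.Adj a b ∧ G.Adj b d ∧ G.Adj d e ∧ G.Adj e a ∧
    a ≠ d ∧ b ≠ e ∧
    c s(a, b) ≠ c s(b, d) ∧ c s(a, b) ≠ c s(d, e) ∧ c s(a, b) ≠ c s(e, a) ∧
    c s(b, d) ≠ c s(d, e) ∧ c s(b, d) ≠ c s(e, a) ∧ c s(d, e) ≠ c s(e, a)

/-- The coloring `c` uses every one of the `k` colors on at least one edge of `G`
(i.e. it uses exactly `k` colors). -/
def SurjOnEdges {V : Type*} {k : ℕ} (G : SimpleGraph V) (c : Sym2 V → Fin k) : Prop :=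
  ∀ i : Fin k, ∃ e ∈ G.edgeSet, c e = i

set_option linter.unusedSectionVars false

section MultipartiteColoring

variable {V ι α : Type*} [DecidableEq V] [DecidableEq ι] [DecidableEq α]

/-- The colors of the edges inside `S` of the complete multipartite graph whose parts are the
fibres of `π`. -/
def edgeColors (π : V → ι) (f : V → V → α) (S : Finset V) : Finset α :=
  ((S ×ˢ S).filter fun p => π p.1 ≠ π p.2).image fun p => f p.1 p.2

/-- No 4-cycle of the complete multipartite graph with parts the fibres of `π` is rainbow. -/
def NoRainbowC4 (π : V → ι) (f : V → V → α) : Prop :=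
  ∀ a b d e : V, π a ≠ π b → π b ≠ π d → π d ≠ π e → π e ≠ π a → a ≠ d → b ≠ e →
    f a b = f b d ∨ f a b = f d e ∨ f a b = f e a ∨
      f b d = f d e ∨ f b d = f e a ∨ f d e = f e a

/-- `ab` is an edge inside `S`, and every edge inside `S` of the same color contains `a`. -/
structure IsArc (π : V → ι) (f : V → V → α) (S : Finset V) (a b : V) : Prop where
  left_mem : a ∈ S
  right_mem : b ∈ S
  adj : π a ≠ π b
  saturated : ∀ x ∈ S, ∀ y ∈ S, π x ≠ π y → f x y = f a b → x = a ∨ y = a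

/-- `u 0, …, u (k - 1)` is a directed cycle of arcs. -/
structure IsArcCycle (π : V → ι) (f : V → V → α) (S : Finset V) (k : ℕ) (u : ℕ → V) : Prop where
  inj : ∀ i < k, ∀ j < k, u i = u j → i = j
  arc : ∀ i, i + 1 < k → IsArc π f S (u i) (u (i + 1))
  last : IsArc π f S (u (k - 1)) (u 0)

/-- Every cut of `S` is crossed, outside any prescribed color, by a color that occurs only on
the cut. -/
def CutRich (π : V → ι) (f : V → V → α) (S : Finset V) : Prop :=
  ∀ X ⊆ S, X.Nonempty → X ≠ S → ∀ β, ∃ x ∈ X, ∃ y ∈ S \ X, π x ≠ π y ∧ f x y ≠ β ∧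
    f x y ∉ edgeColors π f X ∧ f x y ∉ edgeColors π f (S \ X)

/-- A cycle of arcs whose parts repeat with period three and none of whose chords has the color
of one of its edges. -/
structure IsPeriodicCycle (π : V → ι) (f : V → V → α) (S : Finset V) (k : ℕ)
    (v : ZMod k → V) : Prop where
  inj : Function.Injective v
  arc : ∀ i, IsArc π f S (v i) (v (i + 1))
  length : k = 3 ∨ 6 ≤ k
  periodic : ∀ i, π (v (i + 3)) = π (v i)
  chord : ∀ i j m, π (v i) ≠ π (v j) → j ≠ i + 1 → i ≠ j + 1 →
    f (v i) (v j) ≠ f (v m) (v (m + 1))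

/-- A rainbow walk of length `l` with both ends in `R`, all other vertices in `S \ R`, and no
color occurring inside `R`. -/
structure IsEar (π : V → ι) (f : V → V → α) (S R : Finset V) (l : ℕ) (x : ℕ → V) : Prop where
  two_le : 2 ≤ l
  first_mem : x 0 ∈ R
  last_mem : x l ∈ R
  inner_mem : ∀ m, 0 < m → m < l → x m ∈ S \ R
  adj : ∀ m < l, π (x m) ≠ π (x (m + 1))
  new : ∀ m < l, f (x m) (x (m + 1)) ∉ edgeColors π f R
  rainbow : ∀ m < l, ∀ n < l, f (x m) (x (m + 1)) = f (x n) (x (n + 1)) → m = n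

variable {π : V → ι} {f : V → V → α} {S R : Finset V} {k l : ℕ}

theorem mem_edgeColors {β : α} :
    β ∈ edgeColors π f S ↔ ∃ x ∈ S, ∃ y ∈ S, π x ≠ π y ∧ f x y = β := by
  simp only [edgeColors, mem_image, mem_filter, mem_product, Prod.exists]
  constructor
  · rintro ⟨x, y, ⟨⟨hx, hy⟩, hxy⟩, h⟩
    exact ⟨x, hx, y, hy, hxy, h⟩
  · rintro ⟨x, hx, y, hy, hxy, h⟩
    exact ⟨x, y, ⟨⟨hx, hy⟩, hxy⟩, h⟩

theorem edgeColors_mono {X : Finset V} (h : X ⊆ S) : edgeColors π f X ⊆ edgeColors π f S := by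
  intro β hβ
  obtain ⟨x, hx, y, hy, hxy, e⟩ := mem_edgeColors.1 hβ
  exact mem_edgeColors.2 ⟨x, h hx, y, h hy, hxy, e⟩

theorem CutRich.exists_arc (h : CutRich π f S) (hS : 2 ≤ S.card)
    {a : V} (ha : a ∈ S) (β : α) : ∃ b, IsArc π f S a b ∧ f a b ≠ β := by
  obtain ⟨x, hx, y, hy, hxy, hβ, -, h2⟩ := h {a} (by simpa using ha) (by simp)
    (by rintro rfl; simp at hS) β
  obtain rfl : x = a := by simpa using hx
  refine ⟨y, ⟨ha, (mem_sdiff.1 hy).1, hxy, fun p hp q hq hpq e => ?_⟩, hβ⟩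
  by_contra! hne
  exact h2 (mem_edgeColors.2 ⟨p, by simp [hp, hne.1], q, by simp [hq, hne.2], hpq, e⟩)

theorem exists_arcCycle (hsymm : ∀ x y, f x y = f y x) (hS : S.Nonempty)
    (h : ∀ a ∈ S, ∀ β, ∃ b, IsArc π f S a b ∧ f a b ≠ β) :
    ∃ k, 3 ≤ k ∧ ∃ u, IsArcCycle π f S k u := by
  classical
  obtain ⟨a₀, ha₀⟩ := hS
  obtain ⟨b₀, hb₀, -⟩ := h a₀ ha₀ (f a₀ a₀)
  let A := {p : V × V // IsArc π f S p.1 p.2}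
  have step : ∀ p : A, ∃ q : A, q.1.1 = p.1.2 ∧ f q.1.1 q.1.2 ≠ f p.1.1 p.1.2 := by
    intro p
    obtain ⟨b, hb, hne⟩ := h p.1.2 p.2.right_mem (f p.1.1 p.1.2)
    exact ⟨⟨(p.1.2, b), hb⟩, rfl, hne⟩
  choose g hg1 hg2 using step
  let s : ℕ → A := fun n => g^[n] ⟨(a₀, b₀), hb₀⟩
  have hs : ∀ n, s (n + 1) = g (s n) := fun n => Function.iterate_succ_apply' g n _
  let w : ℕ → V := fun n => (s n).1.1
  have hw : ∀ n, (s n).1.2 = w (n + 1) := fun n => by simp only [w, hs, hg1]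
  have harc : ∀ n, IsArc π f S (w n) (w (n + 1)) := fun n => by
    rw [← hw]; exact (s n).2
  have hne : ∀ n, f (w (n + 1)) (w (n + 2)) ≠ f (w n) (w (n + 1)) := fun n => by
    have := hg2 (s n)
    rw [← hs, hw, hw] at this
    exact this
  have hrep : ∃ d, 0 < d ∧ ∃ i, w i = w (i + d) := by
    obtain ⟨i, -, j, -, hij, e⟩ := Set.infinite_univ.exists_ne_map_eq_of_mapsTo
      (f := w) (t := (S : Set V)) (fun n _ => (harc n).left_mem) S.finite_toSet
    rcases lt_or_gt_of_ne hij with hlt | hlt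
    · exact ⟨j - i, by omega, i, by rw [e]; congr 1; omega⟩
    · exact ⟨i - j, by omega, j, by rw [← e]; congr 1; omega⟩
  obtain ⟨hd, i, hi⟩ := Nat.find_spec hrep
  have hmin := fun m (hm : m < Nat.find hrep) => Nat.find_min hrep hm
  set d := Nat.find hrep
  have hd1 : d ≠ 1 := fun e => (harc i).adj (by rw [e] at hi; rw [← hi])
  have hd2 : d ≠ 2 := fun e => by
    rw [e] at hi
    apply hne i
    rw [← hi, hsymm]
  refine ⟨d, by omega, fun n => w (i + n), ?_, ?_, ?_⟩
  · intro p hp q hq e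
    by_contra hpq
    rcases lt_or_gt_of_ne hpq with hlt | hlt
    · refine hmin (q - p) (by omega) ⟨by omega, i + p, ?_⟩
      simp only [e]; congr 1; omega
    · refine hmin (p - q) (by omega) ⟨by omega, i + q, ?_⟩
      simp only [← e]; congr 1; omega
  · intro n _
    exact harc (i + n)
  · have := harc (i + (d - 1))
    rw [show i + (d - 1) + 1 = i + d by omega, ← hi] at this
    simpa using this

theorem ZMod.natCast_ne_zero_of_lt {m : ℕ} (h0 : 0 < m) (h : m < k) : (m : ZMod k) ≠ 0 := by
  rw [Ne, ZMod.natCast_eq_zero_iff]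
  exact Nat.not_dvd_of_pos_of_lt h0 h

/-- Distinct arcs of a cycle have distinct colors. -/
theorem IsArc.color_injective (h2 : (2 : ZMod k) ≠ 0) {v : ZMod k → V}
    (hv : Function.Injective v) (harc : ∀ i, IsArc π f S (v i) (v (i + 1))) {i j : ZMod k}
    (e : f (v i) (v (i + 1)) = f (v j) (v (j + 1))) : i = j := by
  have h1 := (harc i).saturated _ (harc j).left_mem _ (harc j).right_mem (harc j).adj e.symm
  have h2 := (harc j).saturated _ (harc i).left_mem _ (harc i).right_mem (harc i).adj e
  simp only [hv.eq_iff] at h1 h2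
  rcases h1 with h1 | h1
  · exact h1.symm
  rcases h2 with h2 | h2
  · exact h2
  exact absurd (by linear_combination h1 + h2) ‹(2 : ZMod k) ≠ 0›

/-- A set of arcs indexed by `ZMod k` can be cut short along an arc that joins two vertices. -/
theorem IsArcCycle.shortcut [NeZero k] {v : ZMod k → V} (hv : Function.Injective v)
    (harc : ∀ i, IsArc π f S (v i) (v (i + 1))) {i : ZMod k} {d : ℕ} (hd : 2 ≤ d)
    (hdk : d + 2 ≤ k) (h : IsArc π f S (v i) (v (i + d))) :
    IsArcCycle π f S (k - d + 1)
      (fun n => if n = 0 then v i else v (i + ((d + (n - 1) : ℕ) : ZMod k))) := by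
  have hcast : ∀ m < k, ∀ n < k, (m : ZMod k) = n → m = n := by
    intro m hm n hn e
    rwa [ZMod.natCast_eq_natCast_iff', Nat.mod_eq_of_lt hm, Nat.mod_eq_of_lt hn] at e
  refine ⟨?_, ?_, ?_⟩
  · intro p hp q hq e
    by_cases hp0 : p = 0 <;> by_cases hq0 : q = 0
    · omega
    · simp only [hp0, hq0, if_true, if_false] at e
      have := hv e
      exact absurd (by simpa using this.symm) (ZMod.natCast_ne_zero_of_lt (k := k)
        (m := d + (q - 1)) (by omega) (by omega))
    · simp only [hp0, hq0, if_true, if_false] at e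
      have := hv e
      exact absurd (by simpa using this) (ZMod.natCast_ne_zero_of_lt (k := k)
        (m := d + (p - 1)) (by omega) (by omega))
    · simp only [hp0, hq0, if_false] at e
      have := hcast _ (by omega) _ (by omega) (add_left_cancel (hv e))
      omega
  · intro n hn
    by_cases hn0 : n = 0
    · subst hn0; simpa using h
    · simp only [hn0, if_false, Nat.add_eq_zero_iff, one_ne_zero, and_false]
      have := harc (i + ((d + (n - 1) : ℕ) : ZMod k))
      rw [add_assoc, ← Nat.cast_succ] at this
      convert this using 4
      omega
  · have := harc (i + ((d + (k - d - 1) : ℕ) : ZMod k))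
    rw [add_assoc, ← Nat.cast_succ, show (d + (k - d - 1)).succ = k by omega] at this
    simpa [show k - d ≠ 0 by omega] using this

/-- A shortest cycle of arcs is periodic. -/
theorem IsArcCycle.isPeriodicCycle_of_minimal (hsymm : ∀ x y, f x y = f y x)
    (hC4 : NoRainbowC4 π f) {u : ℕ → V} (hk : 3 ≤ k) (hu : IsArcCycle π f S k u)
    (hmin : ∀ m < k, 3 ≤ m → ∀ w, ¬IsArcCycle π f S m w) :
    ∃ v : ZMod k → V, IsPeriodicCycle π f S k v := by
  have : NeZero k := ⟨by omega⟩
  have : Fact (1 < k) := ⟨by omega⟩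
  have ne0 : ∀ m : ℕ, 0 < m → m < k → (m : ZMod k) ≠ 0 := fun m h0 hm =>
    ZMod.natCast_ne_zero_of_lt h0 hm
  have n1 := ne0 1 (by omega) (by omega)
  have n2 := ne0 2 (by omega) (by omega)
  push_cast at n1 n2
  let v : ZMod k → V := fun i => u i.val
  have hinj : Function.Injective v := fun i j e =>
    ZMod.val_injective k (hu.inj _ (ZMod.val_lt i) _ (ZMod.val_lt j) e)
  have harc : ∀ i, IsArc π f S (v i) (v (i + 1)) := by
    intro i
    have hi := ZMod.val_lt i
    by_cases hlt : i.val + 1 < k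
    · have := hu.arc _ hlt
      rwa [← ZMod.val_one k, ← ZMod.val_add_of_lt (by rwa [ZMod.val_one k])] at this
    · have hi' : i.val = k - 1 := by omega
      have h0 : (i + 1).val = 0 := by
        rw [ZMod.val_add, ZMod.val_one k, hi', show k - 1 + 1 = k by omega, Nat.mod_self]
      have := hu.last
      rwa [← hi', ← h0] at this
  have hedge {i j : ZMod k} := IsArc.color_injective n2 hinj harc (i := i) (j := j)
  have hshort : ∀ i j, π (v i) ≠ π (v j) → j ≠ i + 1 → i ≠ j + 1 →
      f (v i) (v j) ≠ f (v i) (v (i + 1)) := by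
    intro i j hij hj hi e
    have hji : i + ((j - i).val : ZMod k) = j := by simp
    have hd := ZMod.val_lt (j - i)
    set d := (j - i).val
    have hd0 : d ≠ 0 := by rintro h0; apply hij; rw [← hji, h0]; simp
    have hd1 : d ≠ 1 := by rintro h0; apply hj; rw [← hji, h0]; simp
    have hdk : d + 1 ≠ k := by
      rintro h0; apply hi; rw [← hji, add_assoc, ← Nat.cast_succ, Nat.succ_eq_add_one, h0]; simp
    have hnew : IsArc π f S (v i) (v (i + d)) := by
      rw [hji]
      exact ⟨(harc i).left_mem, (harc j).left_mem, hij, by rw [e]; exact (harc i).saturated⟩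
    exact hmin (k - d + 1) (by omega) (by omega) _
      (IsArcCycle.shortcut hinj harc (by omega) (by omega) hnew)
  have hchord : ∀ i j m, π (v i) ≠ π (v j) → j ≠ i + 1 → i ≠ j + 1 →
      f (v i) (v j) ≠ f (v m) (v (m + 1)) := by
    intro i j m hij hj hi e
    have := (harc m).saturated _ (harc i).left_mem _ (harc j).left_mem hij e
    rw [hinj.eq_iff, hinj.eq_iff] at this
    rcases this with rfl | rfl
    · exact hshort _ _ hij hj hi e
    · rw [hsymm] at e
      exact hshort _ _ hij.symm hi hj e
  have hne : ∀ i, π (v i) ≠ π (v (i + 1)) := fun i => (harc i).adj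
  by_cases hk3 : k = 3
  · refine ⟨v, hinj, harc, Or.inl hk3, fun i => ?_, hchord⟩
    have : (3 : ZMod k) = 0 := by
      have := ZMod.natCast_self k
      rw [hk3] at this ⊢
      exact_mod_cast this
    rw [this, add_zero]
  have n3 := ne0 3 (by omega) (by omega)
  push_cast at n3
  have hquad : ∀ i, π (v (i + 3)) ≠ π (v i) →
      ∃ m, f (v (i + 3)) (v i) = f (v m) (v (m + 1)) ∧ m ≠ i + 3 := by
    intro i hi
    have h1 := hne (i + 1)
    have h2 := hne (i + 2)
    have e1 := @hedge i (i + 1)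
    have e2 := @hedge i (i + 2)
    have e3 := @hedge (i + 1) (i + 2)
    rw [show i + 1 + 1 = i + 2 by ring] at h1 e1 e3
    rw [show i + 2 + 1 = i + 3 by ring] at h2 e2 e3
    have n12 : i ≠ i + 1 := fun h => n1 (by linear_combination -h)
    have n13 : i ≠ i + 2 := fun h => n2 (by linear_combination -h)
    have n23 : i + 1 ≠ i + 2 := fun h => n1 (by linear_combination -h)
    rcases hC4 (v i) (v (i + 1)) (v (i + 2)) (v (i + 3)) (hne i) h1 h2 hi
      (hinj.ne n13) (hinj.ne fun h => n2 (by linear_combination -h)) with h | h | h | h | h | h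
    · exact absurd (e1 h) n12
    · exact absurd (e2 h) n13
    · exact ⟨i, h.symm, fun h => n3 (by linear_combination -h)⟩
    · exact absurd (e3 h) n23
    · exact ⟨i + 1, by rw [← h, show i + 1 + 1 = i + 2 by ring],
        fun h => n2 (by linear_combination -h)⟩
    · exact ⟨i + 2, by rw [← h, show i + 2 + 1 = i + 3 by ring],
        fun h => n1 (by linear_combination -h)⟩
  by_cases hk4 : k = 4
  · exfalso
    have h4 : (4 : ZMod k) = 0 := by
      have := ZMod.natCast_self k
      rw [hk4] at this ⊢
      exact_mod_cast this
    have h34 : ∀ i : ZMod k, i + 3 + 1 = i := fun i => by linear_combination h4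
    have h3 := hne 3
    have := h34 0
    obtain ⟨m, hm, hm3⟩ := hquad 0 (by have := hne (0 + 3); rwa [h34] at this)
    have e := @hedge (0 + 3) m
    rw [h34] at e
    exact hm3 (e hm).symm
  have n4 := ne0 4 (by omega) (by omega)
  push_cast at n4
  have hper : ∀ i, π (v (i + 3)) = π (v i) := by
    intro i
    by_contra hi
    obtain ⟨m, hm, -⟩ := hquad i hi
    exact hchord _ _ m hi (fun h => n4 (by linear_combination -h))
      (fun h => n2 (by linear_combination h)) hm
  refine ⟨v, hinj, harc, Or.inr ?_, hper, hchord⟩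
  by_contra hlt
  have hk5 : k = 5 := by omega
  have h5 : (5 : ZMod k) = 0 := by
    have := ZMod.natCast_self k
    rw [hk5] at this ⊢
    exact_mod_cast this
  apply hne 0
  rw [← hper 0, ← hper (0 + 3)]
  congr 2
  linear_combination h5

theorem exists_periodicCycle (hsymm : ∀ x y, f x y = f y x) (hC4 : NoRainbowC4 π f)
    (h : ∃ k, 3 ≤ k ∧ ∃ u, IsArcCycle π f S k u) :
    ∃ k, ∃ v : ZMod k → V, IsPeriodicCycle π f S k v := by
  classical
  obtain ⟨hk, u, hu⟩ := Nat.find_spec h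
  exact ⟨_, hu.isPeriodicCycle_of_minimal hsymm hC4 hk fun m hm h3 w hw =>
    Nat.find_min h hm ⟨h3, w, hw⟩⟩

namespace IsPeriodicCycle

variable {v : ZMod k → V}

theorem two_ne_zero (hv : IsPeriodicCycle π f S k v) : (2 : ZMod k) ≠ 0 := by
  have := hv.length
  exact_mod_cast ZMod.natCast_ne_zero_of_lt (k := k) (m := 2) (by omega) (by omega)

theorem one_ne_zero (hv : IsPeriodicCycle π f S k v) : (1 : ZMod k) ≠ 0 := fun h =>
  hv.two_ne_zero (by linear_combination 2 * h)

theorem color_injective (hv : IsPeriodicCycle π f S k v) {i j : ZMod k}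
    (e : f (v i) (v (i + 1)) = f (v j) (v (j + 1))) : i = j :=
  IsArc.color_injective hv.two_ne_zero hv.inj hv.arc e

theorem part_ne_succ (hv : IsPeriodicCycle π f S k v) (i : ZMod k) :
    π (v i) ≠ π (v (i + 1)) := (hv.arc i).adj

theorem part_ne_pred (hv : IsPeriodicCycle π f S k v) (i : ZMod k) :
    π (v i) ≠ π (v (i - 1)) := by
  have := hv.part_ne_succ (i - 1)
  rw [sub_add_cancel] at this
  exact this.symm

theorem part_add_two (hv : IsPeriodicCycle π f S k v) (i : ZMod k) :
    π (v (i + 1 + 1)) = π (v (i - 1)) := by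
  rw [← hv.periodic (i - 1)]
  congr 2
  ring

theorem part_succ_ne_pred (hv : IsPeriodicCycle π f S k v) (i : ZMod k) :
    π (v (i + 1)) ≠ π (v (i - 1)) := by
  rw [← hv.part_add_two]
  exact hv.part_ne_succ (i + 1)

/-- Up to a cyclic rotation, any two vertices of the cycle see the same parts around them. -/
theorem part_cases (hv : IsPeriodicCycle π f S k v) (i j : ZMod k) :
    (π (v j) = π (v i) ∧ π (v (j + 1)) = π (v (i + 1)) ∧ π (v (j - 1)) = π (v (i - 1))) ∨
    (π (v j) = π (v (i + 1)) ∧ π (v (j + 1)) = π (v (i - 1)) ∧ π (v (j - 1)) = π (v i)) ∨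
    (π (v j) = π (v (i - 1)) ∧ π (v (j + 1)) = π (v i) ∧
      π (v (j - 1)) = π (v (i + 1))) := by
  have : NeZero k := ⟨by have := hv.length; omega⟩
  obtain ⟨n, rfl⟩ : ∃ n : ℕ, j = i + n := ⟨(j - i).val, by simp⟩
  induction n with
  | zero => simp
  | succ n ih =>
    have h := hv.part_add_two (i + n)
    rw [Nat.cast_succ, ← add_assoc, add_sub_cancel_right]
    rcases ih with ⟨h1, h2, h3⟩ | ⟨h1, h2, h3⟩ | ⟨h1, h2, h3⟩
    · exact Or.inr (Or.inl ⟨h2, h.trans h3, h1⟩)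
    · exact Or.inr (Or.inr ⟨h2, h.trans h3, h1⟩)
    · exact Or.inl ⟨h2, h.trans h3, h1⟩

theorem exists_mid_succ (hsymm : ∀ x y, f x y = f y x) (hv : IsPeriodicCycle π f S k v)
    (i : ZMod k) :
    ∃ m, π (v i) ≠ π (v m) ∧ π (v m) ≠ π (v (i + 1)) ∧
      f (v i) (v m) ≠ f (v m) (v (i + 1)) := by
  refine ⟨i - 1, hv.part_ne_pred i, (hv.part_succ_ne_pred i).symm, ?_⟩
  have e : f (v i) (v (i - 1)) = f (v (i - 1)) (v (i - 1 + 1)) := by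
    rw [sub_add_cancel, hsymm]
  rw [e]
  by_cases h3 : i - 1 = i + 1 + 1
  · rw [hsymm (v (i - 1)) (v (i + 1))]
    intro h
    have := hv.color_injective (h.trans (by rw [← h3]))
    exact hv.two_ne_zero (by linear_combination -this)
  · exact (hv.chord _ _ _ (hv.part_succ_ne_pred i).symm
      (fun h => hv.one_ne_zero (by linear_combination h)) h3).symm

/-- Any two vertices of the cycle are joined by a path of length two with two colors. -/
theorem exists_mid (hsymm : ∀ x y, f x y = f y x) (hv : IsPeriodicCycle π f S k v)
    {i j : ZMod k} (hij : i ≠ j) :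
    ∃ m, π (v i) ≠ π (v m) ∧ π (v m) ≠ π (v j) ∧ f (v i) (v m) ≠ f (v m) (v j) := by
  by_cases hj : j = i + 1
  · exact hj ▸ hv.exists_mid_succ hsymm i
  by_cases hi : i = j + 1
  · obtain ⟨m, h1, h2, h3⟩ := hv.exists_mid_succ hsymm j
    subst hi
    refine ⟨m, h2.symm, h1.symm, ?_⟩
    rw [hsymm (v (j + 1)), hsymm (v m) (v j)]
    exact h3.symm
  by_cases hp : π (v (i + 1)) = π (v j)
  · refine ⟨i - 1, hv.part_ne_pred i, hp ▸ (hv.part_succ_ne_pred i).symm, ?_⟩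
    have e : f (v i) (v (i - 1)) = f (v (i - 1)) (v (i - 1 + 1)) := by
      rw [sub_add_cancel, hsymm]
    rw [e]
    by_cases h : i - 1 = j + 1
    · rw [h, hsymm _ (v j)]
      intro h'
      exact hv.one_ne_zero (by linear_combination hv.color_injective h')
    · exact (hv.chord _ _ _ (hp ▸ (hv.part_succ_ne_pred i).symm)
        (fun h => hij (by linear_combination -h)) h).symm
  · refine ⟨i + 1, hv.part_ne_succ i, hp, ?_⟩
    by_cases h : j = i + 1 + 1
    · rw [h]
      intro h'
      exact hv.one_ne_zero (by linear_combination -hv.color_injective h')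
    · exact (hv.chord _ _ _ hp h fun h => hij (by linear_combination h)).symm

theorem chord_shift (hsymm : ∀ x y, f x y = f y x) (hC4 : NoRainbowC4 π f)
    (hv : IsPeriodicCycle π f S k v) {i j : ZMod k} (hij : π (v i) ≠ π (v j))
    (hj : j ≠ i + 1) (hi : i ≠ j + 1) (n : ℕ) :
    π (v (i + n)) ≠ π (v (j + n)) ∧ f (v (i + n)) (v (j + n)) = f (v i) (v j) := by
  induction n with
  | zero => simpa using hij
  | succ n ih =>
    obtain ⟨h1, h2⟩ := ih
    have h3 : π (v (i + n + 1)) ≠ π (v (j + n + 1)) := by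
      have := hv.part_ne_succ (i + n)
      have := hv.part_ne_pred (i + n)
      have := hv.part_succ_ne_pred (i + n)
      rcases hv.part_cases (i + n) (j + n) with ⟨_, h, _⟩ | ⟨_, h, _⟩ | ⟨_, h, _⟩
      · exact absurd ‹_› h1.symm
      · rw [h]; assumption
      · rw [h]; exact Ne.symm ‹π (v (i + n)) ≠ π (v (i + n + 1))›
    rw [Nat.cast_succ, ← add_assoc, ← add_assoc]
    refine ⟨h3, ?_⟩
    have hj' : j + n + 1 ≠ i + n + 1 + 1 := fun h => hj (by linear_combination h)
    have hi' : i + n + 1 ≠ j + n + 1 + 1 := fun h => hi (by linear_combination h)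
    have c1 := fun m => hv.chord _ _ m h3 hj' hi'
    have c2 := fun m => hv.chord (i + n) (j + n) m h1 (fun h => hj (by linear_combination h))
      (fun h => hi (by linear_combination h))
    rw [hsymm (v (i + n))] at c2
    rw [← h2, hsymm (v (i + n))]
    rcases hC4 (v (i + n)) (v (i + n + 1)) (v (j + n + 1)) (v (j + n)) (hv.part_ne_succ _) h3
      (hv.part_ne_succ _).symm h1.symm (hv.inj.ne fun h => hi (by linear_combination h))
      (hv.inj.ne fun h => hj (by linear_combination -h)) with h | h | h | h | h | h
    · exact absurd h.symm (c1 _)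
    · rw [hsymm (v (j + n + 1))] at h
      exact absurd (congrArg (fun m => π (v m)) (hv.color_injective h)) h1
    · exact absurd h.symm (c2 _)
    · rw [hsymm (v (j + n + 1))] at h
      exact absurd h (c1 _)
    · exact h
    · rw [hsymm (v (j + n + 1))] at h
      exact absurd h.symm (c2 _)

/-- If a periodic cycle spans `S`, removing three consecutive vertices loses at most four
colors. -/
theorem color_mem_of_span (hsymm : ∀ x y, f x y = f y x) (hC4 : NoRainbowC4 π f)
    (hv : IsPeriodicCycle π f S k v) (hk : 6 ≤ k) (hspan : ∀ x ∈ S, ∃ i, v i = x) {β : α}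
    (hβ : β ∈ edgeColors π f S) :
    β ∈ edgeColors π f (S \ {v 0, v 1, v 2}) ∪
      {f (v (-1)) (v 0), f (v 0) (v 1), f (v 1) (v 2), f (v 2) (v 3)} := by
  have : NeZero k := ⟨by omega⟩
  have hmem : ∀ m : ℕ, 3 ≤ m → m < k → v m ∈ S \ {v 0, v 1, v 2} := by
    intro m h3 hm
    have hne : ∀ n : ℕ, n < 3 → v m ≠ v n := by
      intro n hn e
      have e := hv.inj e
      rw [ZMod.natCast_eq_natCast_iff', Nat.mod_eq_of_lt hm, Nat.mod_eq_of_lt (by omega)] at e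
      omega
    have h0 := hne 0 (by omega)
    have h1 := hne 1 (by omega)
    have h2 := hne 2 (by omega)
    push_cast at h0 h1 h2
    simp only [mem_sdiff, mem_insert, mem_singleton, h0, h1, h2, or_self, not_false_iff, and_true]
    exact (hv.arc m).left_mem
  have hconsec : ∀ i, f (v i) (v (i + 1)) ∈ edgeColors π f (S \ {v 0, v 1, v 2}) ∪
      {f (v (-1)) (v 0), f (v 0) (v 1), f (v 1) (v 2), f (v 2) (v 3)} := by
    intro i
    obtain ⟨m, hm, rfl⟩ : ∃ m : ℕ, m < k ∧ i = m := ⟨i.val, ZMod.val_lt i, by simp⟩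
    rw [mem_union]
    by_cases h0 : m < 3
    · right
      simp only [mem_insert, mem_singleton]
      interval_cases m
      · simp
      · norm_num
      · norm_num
    by_cases h1 : m + 1 = k
    · right
      have h : (m : ZMod k) = -1 := by
        have : ((m + 1 : ℕ) : ZMod k) = 0 := by rw [h1, ZMod.natCast_self]
        push_cast at this
        linear_combination this
      simp [h]
    · left
      refine mem_edgeColors.2 ⟨_, hmem m (by omega) hm, v (m + 1), ?_, hv.part_ne_succ _, rfl⟩
      exact_mod_cast hmem (m + 1) (by omega) (by omega)
  obtain ⟨x, hx, y, hy, hxy, rfl⟩ := mem_edgeColors.1 hβ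
  obtain ⟨i, rfl⟩ := hspan x hx
  obtain ⟨j, rfl⟩ := hspan y hy
  by_cases hj : j = i + 1
  · rw [hj]; exact hconsec i
  by_cases hi : i = j + 1
  · rw [hi, hsymm (v (j + 1))]; exact hconsec j
  refine mem_union_left _ ?_
  have key := hv.chord_shift hsymm hC4 hxy hj hi
  by_cases h2 : i = j + 2
  · obtain ⟨h3, h4⟩ := key (3 - j).val
    rw [ZMod.natCast_zmod_val] at h3 h4
    refine mem_edgeColors.2 ⟨_, ?_, _, ?_, h3, h4⟩
    · have := hmem 5 (by omega) (by omega)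
      push_cast at this
      convert this using 2
      linear_combination h2
    · have := hmem 3 (by omega) (by omega)
      push_cast at this
      convert this using 2
      ring
  · obtain ⟨h3, h4⟩ := key (3 - i).val
    have hd := ZMod.val_lt (j - i)
    have hdj : ((j - i).val : ZMod k) = j - i := by simp
    rw [ZMod.natCast_zmod_val] at h3 h4
    have hfar : (j - i).val + 3 < k := by
      by_contra hlt
      obtain ⟨r, hr, hr3⟩ : ∃ r, (j - i).val + r = k ∧ r ≤ 3 :=
        ⟨k - (j - i).val, by omega, by omega⟩
      have hk0 : (((j - i).val + r : ℕ) : ZMod k) = 0 := by rw [hr, ZMod.natCast_self]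
      rw [Nat.cast_add, hdj] at hk0
      interval_cases r
      · omega
      · exact hi (by push_cast at hk0; linear_combination -hk0)
      · exact h2 (by push_cast at hk0; linear_combination -hk0)
      · refine hxy ?_
        rw [← hv.periodic j]
        congr 2
        push_cast at hk0
        linear_combination -hk0
    refine mem_edgeColors.2 ⟨_, ?_, _, ?_, h3, h4⟩
    · have := hmem 3 (by omega) (by omega)
      push_cast at this
      convert this using 2
      ring
    · have := hmem ((j - i).val + 3) (by omega) hfar
      rw [Nat.cast_add, hdj] at this
      push_cast at this
      convert this using 2
      ring

end IsPeriodicCycle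

/-- If every cut of `S` is rich, every proper nonempty subset of `S` has an ear. -/
theorem CutRich.exists_ear (hsymm : ∀ x y, f x y = f y x) (h : CutRich π f S) (hRS : R ⊆ S)
    (hR : R.Nonempty) (hne : R ≠ S) : ∃ l x, IsEar π f S R l x := by
  classical
  obtain ⟨r, -⟩ := id hR
  obtain ⟨a, ha, p, hp, hap, -, hnew, -⟩ := h R hRS hR hne (f r r)
  have hrep : ∀ γ, ∃ q : V × V, γ ∈ edgeColors π f S →
      q.1 ∈ S ∧ q.2 ∈ S ∧ π q.1 ≠ π q.2 ∧ f q.1 q.2 = γ := by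
    intro γ
    by_cases hγ : γ ∈ edgeColors π f S
    · obtain ⟨x, hx, y, hy, hxy, e⟩ := mem_edgeColors.1 hγ
      exact ⟨(x, y), fun _ => ⟨hx, hy, hxy, e⟩⟩
    · exact ⟨(r, r), fun h => absurd h hγ⟩
  choose rep hrep using hrep
  let G : SimpleGraph V :=
    { Adj := fun x y => (x ∈ S ∧ y ∈ S) ∧ π x ≠ π y ∧ f x y ∉ edgeColors π f R ∧
        f x y ≠ f a p ∧ (rep (f x y) = (x, y) ∨ rep (f x y) = (y, x))
      symm := ⟨fun x y ⟨h1, h2, h3, h4, h5⟩ => by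
        rw [hsymm x y] at h3 h4 h5
        exact ⟨h1.symm, h2.symm, h3, h4, h5.symm⟩⟩
      loopless := ⟨fun x hx => hx.2.1 rfl⟩ }
  have hGinj : ∀ {x y z w}, G.Adj x y → G.Adj z w → f x y = f z w →
      (x = z ∧ y = w) ∨ (x = w ∧ y = z) := by
    rintro x y z w ⟨-, -, -, -, h1⟩ ⟨-, -, -, -, h2⟩ e
    rw [e] at h1
    rcases h1 with h1 | h1 <;> rcases h2 with h2 | h2 <;> rw [h1, Prod.mk.injEq] at h2
    · exact Or.inl h2
    · exact Or.inr h2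
    · exact Or.inr h2.symm
    · exact Or.inl h2.symm
  let H : SimpleGraph V :=
    { Adj := fun x y => G.Adj x y ∧ x ∉ R ∧ y ∉ R
      symm := ⟨fun x y hxy => ⟨hxy.1.symm, hxy.2.2, hxy.2.1⟩⟩
      loopless := ⟨fun x hx => G.loopless.irrefl x hx.1⟩ }
  have hwalk : ∀ {y} (w : H.Walk p y) (m : ℕ), w.getVert m ∈ S \ R := by
    intro y w m
    induction m with
    | zero => simpa using hp
    | succ m ih =>
      by_cases hm : m < w.length
      · obtain ⟨h1, -, h2⟩ := w.adj_getVert_succ hm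
        exact mem_sdiff.2 ⟨h1.1.2, h2⟩
      · rw [w.getVert_of_length_le (by omega)] at ih ⊢
        exact ih
  obtain ⟨y, z, hy, hz, hyz⟩ : ∃ y z, H.Reachable p y ∧ z ∈ R ∧ G.Adj y z := by
    by_contra! hno
    let Y := S.filter fun y => H.Reachable p y
    have hYR : ∀ y ∈ Y, y ∉ R := by
      intro y hy
      obtain ⟨w⟩ := (mem_filter.1 hy).2
      have := hwalk w w.length
      rw [w.getVert_length] at this
      exact (mem_sdiff.1 this).2
    have hRY : R ⊆ S \ Y := fun x hx => mem_sdiff.2 ⟨hRS hx, fun hxY => hYR x hxY hx⟩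
    have hpY : p ∈ Y := mem_filter.2 ⟨(mem_sdiff.1 hp).1, SimpleGraph.Reachable.refl p⟩
    obtain ⟨x, hx, y, hy, hxy, hβ, h1, h2⟩ := h Y (filter_subset _ _) ⟨p, hpY⟩
      (fun e => hYR a (e ▸ hRS ha) ha) (f a p)
    obtain ⟨r1, r2, r3, r4⟩ := hrep (f x y)
      (mem_edgeColors.2 ⟨x, (mem_filter.1 hx).1, y, (mem_sdiff.1 hy).1, hxy, rfl⟩)
    have hG : G.Adj (rep (f x y)).1 (rep (f x y)).2 := by
      refine ⟨⟨r1, r2⟩, r3, ?_, ?_, ?_⟩ <;> rw [r4]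
      · exact fun hR => h2 (edgeColors_mono hRY hR)
      · exact hβ
      · exact Or.inl rfl
    have hstep : ∀ {s t}, G.Adj s t → s ∈ Y → t ∈ Y := by
      intro s t hst hs
      have hs' := (mem_filter.1 hs).2
      have hH : H.Adj s t := ⟨hst, hYR s hs, fun ht => hno s t hs' ht hst⟩
      exact mem_filter.2 ⟨hst.1.2, hs'.trans hH.reachable⟩
    by_cases hs : (rep (f x y)).1 ∈ Y
    · exact h1 (mem_edgeColors.2 ⟨_, hs, _, hstep hG hs, r3, r4⟩)
    · exact h2 (mem_edgeColors.2 ⟨_, mem_sdiff.2 ⟨r1, hs⟩, _,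
        mem_sdiff.2 ⟨r2, fun ht => hs (hstep hG.symm ht)⟩, r3, r4⟩)
  obtain ⟨w, hw⟩ := hy.exists_isPath
  let x : ℕ → V := fun n => if n = 0 then a else if n ≤ w.length + 1 then w.getVert (n - 1) else z
  have x0 : x 0 = a := rfl
  have xs : ∀ n ≤ w.length, x (n + 1) = w.getVert n := fun n hn => by
    simp [x, hn]
  have xl : x (w.length + 2) = z := by simp [x]
  have hG : ∀ m ≤ w.length, G.Adj (x (m + 1)) (x (m + 2)) := by
    intro m hm
    rcases hm.lt_or_eq with hlt | rfl
    · rw [xs m hm, xs (m + 1) hlt]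
      exact (w.adj_getVert_succ hlt).1
    · rw [xs _ le_rfl, xl, w.getVert_length]
      exact hyz
  have hxR : ∀ m ≤ w.length, x (m + 1) ∈ S \ R := fun m hm => xs m hm ▸ hwalk w m
  have hinj : ∀ m ≤ w.length + 1, ∀ n ≤ w.length + 1, x (m + 1) = x (n + 1) → m = n := by
    intro m hm n hn e
    by_cases hm' : m ≤ w.length <;> by_cases hn' : n ≤ w.length
    · rw [xs m hm', xs n hn'] at e
      exact hw.getVert_injOn hm' hn' e
    · obtain rfl : n = w.length + 1 := by omega
      rw [xl] at e
      exact absurd (e ▸ hz) (mem_sdiff.1 (hxR m hm')).2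
    · obtain rfl : m = w.length + 1 := by omega
      rw [xl] at e
      exact absurd (e ▸ hz) (mem_sdiff.1 (hxR n hn')).2
    · omega
  refine ⟨w.length + 2, x, by omega, ha, xl ▸ hz, ?_, ?_, ?_, ?_⟩
  · rintro (_ | m) h0 hm
    · omega
    · exact hxR m (by omega)
  · rintro (_ | m) hm
    · rw [xs 0 (by omega), w.getVert_zero]
      exact hap
    · exact (hG m (by omega)).2.1
  · rintro (_ | m) hm
    · rw [xs 0 (by omega), w.getVert_zero]
      exact hnew
    · exact (hG m (by omega)).2.2.1
  · have h01 : x (0 + 1) = p := by rw [xs 0 (by omega), w.getVert_zero]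
    rintro (_ | m) hm (_ | n) hn e
    · rfl
    · rw [h01] at e
      exact absurd e.symm (hG n (by omega)).2.2.2.1
    · rw [h01] at e
      exact absurd e (hG m (by omega)).2.2.2.1
    · rcases hGinj (hG m (by omega)) (hG n (by omega)) e with ⟨h1, -⟩ | ⟨h1, h2⟩
      · rw [hinj m (by omega) n (by omega) h1]
      · have := hinj m (by omega) (n + 1) (by omega) h1
        have := hinj (m + 1) (by omega) n (by omega) h2
        omega

namespace IsEar

variable {x : ℕ → V}

theorem reverse (hsymm : ∀ x y, f x y = f y x) (h : IsEar π f S R l x) :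
    IsEar π f S R l fun m => x (l - m) := by
  have hs : ∀ m < l, l - m = l - (m + 1) + 1 := fun m hm => by omega
  refine ⟨h.two_le, by simpa using h.last_mem, by simpa using h.first_mem,
    fun m h0 hm => h.inner_mem _ (by omega) (by omega), ?_, ?_, ?_⟩
  · intro m hm
    simp only [hs m hm]
    exact (h.adj _ (by omega)).symm
  · intro m hm
    simp only [hs m hm]
    rw [hsymm]
    exact h.new _ (by omega)
  · intro m hm n hn e
    simp only [hs m hm, hs n hn] at e
    rw [hsymm, hsymm (x (l - (n + 1) + 1))] at e
    have := h.rainbow _ (by omega) _ (by omega) e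
    omega

/-- An ear may enter at its third vertex through an edge of one of its first two colors. -/
theorem tail (h : IsEar π f S R l x) (hl : 3 ≤ l) {z : V} (hz : z ∈ R)
    (hadj : π z ≠ π (x 2)) (hc : f z (x 2) = f (x 0) (x 1) ∨ f z (x 2) = f (x 1) (x 2)) :
    IsEar π f S R (l - 1) fun m => if m = 0 then z else x (m + 1) := by
  have hl1 : l - 1 ≠ 0 := by omega
  refine ⟨by omega, by simpa using hz, ?_, ?_, ?_, ?_, ?_⟩
  · simp only [hl1, if_false]
    rw [show l - 1 + 1 = l by omega]
    exact h.last_mem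
  · rintro (_ | m) h0 hm
    · omega
    · exact h.inner_mem (m + 2) (by omega) (by omega)
  · rintro (_ | m) hm
    · exact hadj
    · exact h.adj (m + 2) (by omega)
  · rintro (_ | m) hm
    · rcases hc with hc | hc
      · exact fun e => h.new 0 (by omega) (hc ▸ e)
      · exact fun e => h.new 1 (by omega) (hc ▸ e)
    · exact h.new (m + 2) (by omega)
  · have key : ∀ m, m + 1 < l - 1 → f z (x 2) ≠ f (x (m + 2)) (x (m + 3)) := by
      intro m hm e
      rcases hc with hc | hc
      · exact absurd (h.rainbow 0 (by omega) (m + 2) (by omega) (hc ▸ e)) (by omega)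
      · exact absurd (h.rainbow 1 (by omega) (m + 2) (by omega) (hc ▸ e)) (by omega)
    rintro (_ | m) hm (_ | n) hn e
    · rfl
    · exact absurd e (key n hn)
    · exact absurd e.symm (key m hm)
    · have := h.rainbow (m + 2) (by omega) (n + 2) (by omega) e
      omega

/-- Three consecutive edges of an ear may be replaced by one edge of one of their colors. -/
theorem shortcut (h : IsEar π f S R l x) (hl : 4 ≤ l) {m s : ℕ} (hm : m + 3 ≤ l)
    (hadj : π (x m) ≠ π (x (m + 3))) (hs : m ≤ s) (hs' : s ≤ m + 2)
    (hc : f (x m) (x (m + 3)) = f (x s) (x (s + 1))) :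
    IsEar π f S R (l - 2) fun n => if n ≤ m then x n else x (n + 2) := by
  have hcol : ∀ n < l - 2, ∃ q < l, ((n < m ∧ q = n) ∨ (n = m ∧ q = s) ∨ (m < n ∧ q = n + 2)) ∧
      π (if n ≤ m then x n else x (n + 2)) ≠
        π (if n + 1 ≤ m then x (n + 1) else x (n + 1 + 2)) ∧
      f (if n ≤ m then x n else x (n + 2)) (if n + 1 ≤ m then x (n + 1) else x (n + 1 + 2)) =
        f (x q) (x (q + 1)) := by
    intro n hn
    rcases lt_trichotomy n m with hlt | rfl | hlt
    · refine ⟨n, by omega, by omega, ?_⟩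
      rw [if_pos (by omega), if_pos (by omega)]
      exact ⟨h.adj n (by omega), rfl⟩
    · refine ⟨s, by omega, by omega, ?_⟩
      rw [if_pos (by omega), if_neg (by omega)]
      exact ⟨hadj, hc⟩
    · refine ⟨n + 2, by omega, by omega, ?_⟩
      rw [if_neg (by omega), if_neg (by omega)]
      exact ⟨h.adj (n + 2) (by omega), rfl⟩
  refine ⟨by omega, by simpa using h.first_mem, ?_, ?_, ?_, ?_, ?_⟩
  · rw [if_neg (by omega), show l - 2 + 2 = l by omega]
    exact h.last_mem
  · intro n h0 hn
    split_ifs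
    · exact h.inner_mem n h0 (by omega)
    · exact h.inner_mem (n + 2) (by omega) (by omega)
  · intro n hn
    obtain ⟨q, -, -, hq, -⟩ := hcol n hn
    exact hq
  · intro n hn
    obtain ⟨q, hq, -, -, e⟩ := hcol n hn
    exact fun hR => h.new q hq (e ▸ hR)
  · intro n hn n' hn' e
    obtain ⟨q, hq, h1, -, e1⟩ := hcol n hn
    obtain ⟨q', hq', h2, -, e2⟩ := hcol n' hn'
    have := h.rainbow q hq q' hq' (e1.symm.trans (e.trans e2))
    omega

theorem part_add_three (hsymm : ∀ x y, f x y = f y x) (hC4 : NoRainbowC4 π f)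
    (h : IsEar π f S R l x) (hl : 4 ≤ l) (hmin : ∀ l' < l, ∀ y, ¬IsEar π f S R l' y)
    {m : ℕ} (hm : m + 3 ≤ l) : π (x m) = π (x (m + 3)) := by
  by_contra hadj
  have hcut := fun s h1 h2 e => hmin _ (by omega) _ (h.shortcut hl hm hadj (s := s) h1 h2 e)
  have hne : ∀ n, n + 2 ≤ l → x n ≠ x (n + 2) := by
    intro n hn e
    have := h.rainbow n (by omega) (n + 1) (by omega) (by rw [← e, hsymm])
    omega
  rcases hC4 (x m) (x (m + 1)) (x (m + 2)) (x (m + 3)) (h.adj _ (by omega))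
    (h.adj _ (by omega)) (h.adj _ (by omega)) (Ne.symm hadj) (hne m (by omega))
    (hne (m + 1) (by omega)) with e | e | e | e | e | e
  · have := h.rainbow _ (by omega) _ (by omega) e
    omega
  · have := h.rainbow _ (by omega) _ (by omega) e
    omega
  · exact hcut m le_rfl (by omega) (by rw [e, hsymm])
  · have := h.rainbow _ (by omega) _ (by omega) e
    omega
  · exact hcut (m + 1) (by omega) (by omega) (by rw [e, hsymm])
  · exact hcut (m + 2) (by omega) (by omega) (by rw [e, hsymm])

variable {v : ZMod k → V}

theorem length_ne_two (hsymm : ∀ x y, f x y = f y x) (hC4 : NoRainbowC4 π f)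
    (hv : IsPeriodicCycle π f S k v) (hR : ∀ y, y ∈ R ↔ ∃ i, v i = y)
    (h : IsEar π f S R l x) : l ≠ 2 := by
  rintro rfl
  obtain ⟨i, hi⟩ := (hR _).1 h.first_mem
  obtain ⟨j, hj⟩ := (hR _).1 h.last_mem
  have h01 : f (x 0) (x 1) ≠ f (x 1) (x 2) := fun e =>
    absurd (h.rainbow 0 (by omega) 1 (by omega) e) (by omega)
  have hij : i ≠ j := by
    rintro rfl
    rw [← hi, ← hj, hsymm] at h01
    exact h01 rfl
  obtain ⟨m, h1, h2, h3⟩ := hv.exists_mid hsymm hij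
  have hnew : ∀ s t, π (v s) ≠ π (v t) → f (v s) (v t) ∈ edgeColors π f R := fun s t hst =>
    mem_edgeColors.2 ⟨_, (hR _).2 ⟨s, rfl⟩, _, (hR _).2 ⟨t, rfl⟩, hst, rfl⟩
  have n1 := hnew _ _ h1
  have n2 := hnew _ _ h2
  have m1 := h.new 0 (by omega)
  have m2 := h.new 1 (by omega)
  have hx1 := (mem_sdiff.1 (h.inner_mem 1 (by omega) (by omega))).2
  rcases hC4 (x 1) (x 0) (v m) (x 2) (h.adj 0 (by omega)).symm (hi ▸ h1) (hj ▸ h2)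
    (h.adj 1 (by omega)).symm (fun e => hx1 (e ▸ (hR _).2 ⟨m, rfl⟩))
    (by rw [← hi, ← hj]; exact hv.inj.ne hij) with e | e | e | e | e | e
  · rw [hsymm, ← hi] at e
    exact m1 (by rw [← hi, e]; exact n1)
  · rw [hsymm, ← hj] at e
    exact m1 (by rw [e]; exact n2)
  · rw [hsymm, hsymm (x 2)] at e
    exact h01 e
  · rw [← hi, ← hj] at e
    exact h3 e
  · rw [hsymm (x 2), ← hi] at e
    exact m2 (by rw [← e]; exact n1)
  · rw [hsymm (x 2), ← hj] at e
    exact m2 (by rw [← hj, ← e]; exact n2)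

theorem part_two (hsymm : ∀ x y, f x y = f y x) (hC4 : NoRainbowC4 π f)
    (hv : IsPeriodicCycle π f S k v) (hR : ∀ y, y ∈ R ↔ ∃ i, v i = y)
    (h : IsEar π f S R l x) (hmin : ∀ l' < l, ∀ y, ¬IsEar π f S R l' y) (hl : 3 ≤ l)
    {i : ZMod k} (hi : π (v i) ≠ π (x 1)) (hc : f (v i) (x 1) = f (x 0) (x 1)) :
    π (x 2) = π (v (i + 1)) := by
  by_contra hadj
  have hvR : ∀ j, v j ∈ R := fun j => (hR _).2 ⟨j, rfl⟩
  have hx1 := (mem_sdiff.1 (h.inner_mem 1 (by omega) (by omega))).2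
  have hx2 := mem_sdiff.1 (h.inner_mem 2 (by omega) (by omega))
  have hold : f (v (i + 1)) (v i) ∈ edgeColors π f R :=
    mem_edgeColors.2 ⟨_, hvR _, _, hvR _, (hv.part_ne_succ i).symm, rfl⟩
  have htail := fun e => hmin _ (by omega) _ (h.tail hl (hvR (i + 1)) (Ne.symm hadj) e)
  rw [hsymm (v (i + 1)) (x 2)] at htail
  rcases hC4 (v i) (x 1) (x 2) (v (i + 1)) hi (h.adj 1 (by omega)) hadj
    (hv.part_ne_succ i).symm (fun e => hx2.2 (e ▸ hvR i)) (fun e => hx1 (e ▸ hvR (i + 1)))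
    with e | e | e | e | e | e
  · exact absurd (h.rainbow 0 (by omega) 1 (by omega) (hc ▸ e)) (by omega)
  · exact htail (Or.inl (e.symm.trans hc))
  · exact h.new 0 (by omega) (by rw [← hc, e]; exact hold)
  · exact htail (Or.inr e.symm)
  · exact h.new 1 (by omega) (by rw [e]; exact hold)
  · rw [hsymm (v (i + 1))] at e
    rcases (hv.arc i).saturated _ hx2.1 _ (hv.arc _).left_mem hadj e with e | e
    · exact hx2.2 (e ▸ hvR i)
    · exact hv.part_ne_succ i (by rw [e])

theorem part_one (hsymm : ∀ x y, f x y = f y x) (hC4 : NoRainbowC4 π f)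
    (hv : IsPeriodicCycle π f S k v) (hR : ∀ y, y ∈ R ↔ ∃ i, v i = y)
    (h : IsEar π f S R l x) (hmin : ∀ l' < l, ∀ y, ¬IsEar π f S R l' y) (hl : 3 ≤ l)
    {i : ZMod k} (hi : v i = x 0) : π (x 1) = π (v (i - 1)) := by
  by_contra hadj
  have hvR : ∀ j, v j ∈ R := fun j => (hR _).2 ⟨j, rfl⟩
  have hx1 := mem_sdiff.1 (h.inner_mem 1 (by omega) (by omega))
  have hx1v : ∀ j, x 1 ≠ v j := fun j e => hx1.2 (e ▸ hvR j)
  have hold : ∀ j, f (v j) (v (j + 1)) ∈ edgeColors π f R := fun j =>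
    mem_edgeColors.2 ⟨_, hvR _, _, hvR _, hv.part_ne_succ j, rfl⟩
  have h01 : π (v i) ≠ π (x 1) := hi ▸ h.adj 0 (by omega)
  have hadj2 : π (v (i + 1 + 1)) ≠ π (x 1) := by
    rw [hv.part_add_two]; exact Ne.symm hadj
  have hii : i ≠ i + 1 + 1 := fun e => hv.two_ne_zero (by linear_combination -e)
  have hnew := h.new 0 (by omega)
  rw [zero_add, ← hi, hsymm] at hnew
  have hsat : ∀ j, j ≠ i + 1 + 1 → f (v j) (v (j + 1)) ≠ f (v (i + 1 + 1)) (x 1) := by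
    intro j hj e
    rcases (hv.arc j).saturated _ (hv.arc _).left_mem _ hx1.1 hadj2 e.symm with e | e
    · exact hj (hv.inj e.symm)
    · exact hx1v j e
  have hcol : f (v (i + 1 + 1)) (x 1) = f (x 0) (x 1) := by
    rcases hC4 (x 1) (v i) (v (i + 1)) (v (i + 1 + 1)) h01.symm (hv.part_ne_succ _)
      (hv.part_ne_succ _) hadj2 (hx1v _) (hv.inj.ne hii) with e | e | e | e | e | e
    · exact absurd (e ▸ hold i) hnew
    · exact absurd (e ▸ hold (i + 1)) hnew
    · rw [← e, hsymm, hi]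
    · exact absurd (hv.color_injective e) fun e => hv.one_ne_zero (by linear_combination -e)
    · exact absurd e (hsat i hii)
    · exact absurd e (hsat (i + 1) fun e => hv.one_ne_zero (by linear_combination -e))
  have e1 := h.part_two hsymm hC4 hv hR hmin hl h01 (by rw [hi])
  have e2 := h.part_two hsymm hC4 hv hR hmin hl hadj2 hcol
  apply hv.part_ne_succ i
  rw [← e1, e2, hv.part_add_two, add_sub_cancel_right]

theorem not_minimal (hsymm : ∀ x y, f x y = f y x) (hC4 : NoRainbowC4 π f)
    (hv : IsPeriodicCycle π f S k v) (hR : ∀ y, y ∈ R ↔ ∃ i, v i = y)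
    (h : IsEar π f S R l x) (hmin : ∀ l' < l, ∀ y, ¬IsEar π f S R l' y) : False := by
  have hl : 3 ≤ l := by
    have := h.two_le
    have := h.length_ne_two hsymm hC4 hv hR
    omega
  have hends : ∀ y i, IsEar π f S R l y → v i = y 0 →
      π (y 1) = π (v (i - 1)) ∧ π (y 2) = π (v (i + 1)) := fun y i hy hi =>
    ⟨hy.part_one hsymm hC4 hv hR hmin hl hi, hy.part_two hsymm hC4 hv hR hmin hl
      (hi ▸ hy.adj 0 (by omega)) (by rw [hi])⟩
  obtain ⟨i, hi⟩ := (hR _).1 h.first_mem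
  obtain ⟨j, hj⟩ := (hR _).1 h.last_mem
  obtain ⟨i1, i2⟩ := hends x i h hi
  obtain ⟨j1, j2⟩ := hends _ j (h.reverse hsymm) (by simpa using hj)
  by_cases hl3 : l = 3
  · subst hl3
    rw [show 3 - 1 = 2 by rfl, i2] at j1
    rw [show 3 - 2 = 1 by rfl, i1] at j2
    rcases hv.part_cases i j with ⟨-, e, -⟩ | ⟨-, -, e⟩ | ⟨-, e, -⟩
    · exact hv.part_succ_ne_pred i (e.symm.trans j2.symm)
    · exact hv.part_ne_succ i (e.symm.trans j1.symm)
    · exact hv.part_ne_pred i (e.symm.trans j2.symm)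
  have hind : ∀ m, m + 2 ≤ l → ∃ s, π (x m) = π (v s) ∧ π (x (m + 1)) = π (v (s - 1)) ∧
      π (x (m + 2)) = π (v (s + 1)) := by
    intro m
    induction m with
    | zero => exact fun _ => ⟨i, by rw [hi], i1, i2⟩
    | succ m ih =>
      intro hm
      obtain ⟨s, h1, h2, h3⟩ := ih (by omega)
      refine ⟨s - 1, h2, ?_, ?_⟩
      · rw [show m + 1 + 1 = m + 2 by rfl, h3, ← hv.periodic (s - 1 - 1)]
        congr 2
        ring
      · rw [show m + 1 + 2 = m + 3 by rfl, sub_add_cancel, ← h1]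
        exact (h.part_add_three hsymm hC4 (by omega) hmin (by omega)).symm
  obtain ⟨s, -, h2, h3⟩ := hind (l - 2) (by omega)
  rw [show l - 2 + 1 = l - 1 by omega, j1] at h2
  rw [show l - 2 + 2 = l by omega, ← hj] at h3
  rcases hv.part_cases s j with ⟨e, -, -⟩ | ⟨-, -, e⟩ | ⟨e, -, -⟩
  · exact hv.part_ne_succ s (e.symm.trans h3)
  · exact hv.part_ne_pred s (e.symm.trans h2)
  · exact hv.part_succ_ne_pred s (h3.symm.trans e)

end IsEar

theorem CutRich.of_card (hsymm : ∀ x y, f x y = f y x) {ν : Finset V → ℕ}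
    (hadd : ∀ A B, Disjoint A B → ν A + ν B ≤ ν (A ∪ B))
    (ih : ∀ T ⊂ S, T.Nonempty → (edgeColors π f T).card + 1 ≤ T.card + ν T)
    (hS : S.card + ν S ≤ (edgeColors π f S).card) : CutRich π f S := by
  intro X hX hXne hXS β
  have hssub : X ⊂ S := hX.ssubset_of_ne hXS
  have hYne : (S \ X).Nonempty := sdiff_nonempty.2 hssub.2
  have h1 := ih X hssub hXne
  have h2 := ih (S \ X) (sdiff_ssubset hX hXne) hYne
  have h3 := hadd X (S \ X) disjoint_sdiff
  rw [union_sdiff_of_subset hX] at h3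
  have h4 := card_sdiff_add_card_eq_card hX
  have h5 := card_union_le (edgeColors π f X) (edgeColors π f (S \ X))
  have h6 := card_insert_le β (edgeColors π f X ∪ edgeColors π f (S \ X))
  obtain ⟨γ, hγ, hγ'⟩ := exists_mem_notMem_of_card_lt_card
    (s := insert β (edgeColors π f X ∪ edgeColors π f (S \ X))) (t := edgeColors π f S) (by omega)
  simp only [mem_insert, mem_union, not_or] at hγ'
  obtain ⟨hβ, hγX, hγY⟩ := hγ'
  obtain ⟨x, hx, y, hy, hxy, rfl⟩ := mem_edgeColors.1 hγ
  by_cases hxX : x ∈ X <;> by_cases hyX : y ∈ X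
  · exact absurd (mem_edgeColors.2 ⟨x, hxX, y, hyX, hxy, rfl⟩) hγX
  · exact ⟨x, hxX, y, mem_sdiff.2 ⟨hy, hyX⟩, hxy, hβ, hγX, hγY⟩
  · rw [hsymm] at hβ hγX hγY
    exact ⟨y, hyX, x, mem_sdiff.2 ⟨hx, hxX⟩, hxy.symm, hβ, hγX, hγY⟩
  · exact absurd (mem_edgeColors.2
      ⟨x, mem_sdiff.2 ⟨hx, hxX⟩, y, mem_sdiff.2 ⟨hy, hyX⟩, hxy, rfl⟩) hγY

/-- If `ν` is superadditive on disjoint sets and positive on triangles, a coloring without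
rainbow 4-cycles has fewer than `|S| + ν S` colors on every nonempty set `S`. -/
theorem card_edgeColors_lt (hsymm : ∀ x y, f x y = f y x) (hC4 : NoRainbowC4 π f)
    {ν : Finset V → ℕ} (hadd : ∀ A B, Disjoint A B → ν A + ν B ≤ ν (A ∪ B))
    (htri : ∀ a b d, π a ≠ π b → π b ≠ π d → π d ≠ π a → 1 ≤ ν {a, b, d})
    (S : Finset V) (hS : S.Nonempty) : (edgeColors π f S).card + 1 ≤ S.card + ν S := by
  classical
  induction S using Finset.strongInduction with
  | H S ih =>
  by_contra hcon
  have hle : S.card + ν S ≤ (edgeColors π f S).card := by omega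
  have hcut := CutRich.of_card hsymm hadd ih hle
  have hcard : 2 ≤ S.card := by
    by_contra hlt
    have h0 : edgeColors π f S = ∅ := by
      rw [eq_empty_iff_forall_notMem]
      intro β hβ
      obtain ⟨x, hx, y, hy, hxy, -⟩ := mem_edgeColors.1 hβ
      exact hxy (congrArg π (card_le_one.1 (by omega) x hx y hy))
    have := hS.card_pos
    rw [h0, card_empty] at hle
    omega
  obtain ⟨k, v, hv⟩ := exists_periodicCycle hsymm hC4
    (exists_arcCycle hsymm hS fun a ha β => hcut.exists_arc hcard ha β)
  have : NeZero k := ⟨by have := hv.length; omega⟩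
  let R : Finset V := univ.image v
  have hR : ∀ y, y ∈ R ↔ ∃ i, v i = y := fun y => by simp [R]
  have hRS : R ⊆ S := by
    intro y hy
    obtain ⟨i, rfl⟩ := (hR y).1 hy
    exact (hv.arc i).left_mem
  by_cases hRe : R = S
  swap
  · have hex := hcut.exists_ear hsymm hRS ⟨v 0, (hR _).2 ⟨0, rfl⟩⟩ hRe
    obtain ⟨x, hx⟩ := Nat.find_spec hex
    exact hx.not_minimal hsymm hC4 hv hR fun m hm y hy => Nat.find_min hex hm ⟨y, hy⟩
  have hspan : ∀ x ∈ S, ∃ i, v i = x := fun x hx => (hR x).1 (hRe ▸ hx)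
  have hTS : {v 0, v 1, v 2} ⊆ S := by
    intro y hy
    simp only [mem_insert, mem_singleton] at hy
    rcases hy with rfl | rfl | rfl <;> exact (hv.arc _).left_mem
  have hp1 := hv.part_ne_succ 0
  have hp2 := hv.part_ne_succ 1
  have hp3 := hv.part_ne_succ 2
  rw [zero_add] at hp1
  rw [one_add_one_eq_two] at hp2
  rw [two_add_one_eq_three, ← zero_add (3 : ZMod k), hv.periodic] at hp3
  have hν := htri _ _ _ hp1 hp2 hp3
  have hTcard : ({v 0, v 1, v 2} : Finset V).card = 3 :=
    card_eq_three.2 ⟨_, _, _, fun e => hp1 (by rw [e]), fun e => hp3 (by rw [e]),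
      fun e => hp2 (by rw [e]), rfl⟩
  have hS' : S.card = k := by
    rw [← hRe, card_image_of_injective _ hv.inj, card_univ, ZMod.card]
  have hadd' := hadd {v 0, v 1, v 2} (S \ {v 0, v 1, v 2}) disjoint_sdiff
  rw [union_sdiff_of_subset hTS] at hadd'
  have hdiff := card_sdiff_add_card_eq_card hTS
  rcases hv.length with rfl | hk
  · have hsub : edgeColors π f S ⊆ univ.image fun i => f (v i) (v (i + 1)) := by
      intro β hβ
      obtain ⟨x, hx, y, hy, hxy, rfl⟩ := mem_edgeColors.1 hβ
      obtain ⟨i, rfl⟩ := hspan x hx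
      obtain ⟨j, rfl⟩ := hspan y hy
      have hcases : ∀ i j : ZMod 3, i = j ∨ j = i + 1 ∨ i = j + 1 := by decide
      rcases hcases i j with rfl | rfl | rfl
      · exact absurd rfl hxy
      · exact mem_image_of_mem _ (mem_univ i)
      · rw [hsymm]
        exact mem_image_of_mem _ (mem_univ j)
    have h1 := (card_le_card hsub).trans card_image_le
    rw [card_univ, ZMod.card] at h1
    omega
  · have hsub := card_le_card fun β hβ => hv.color_mem_of_span hsymm hC4 hk hspan (β := β) hβ
    have h1 := card_union_le (edgeColors π f (S \ {v 0, v 1, v 2}))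
      {f (v (-1)) (v 0), f (v 0) (v 1), f (v 1) (v 2), f (v 2) (v 3)}
    have h2 := card_le_four (a := f (v (-1)) (v 0)) (b := f (v 0) (v 1)) (c := f (v 1) (v 2))
      (d := f (v 2) (v 3))
    have h3 := ih _ (sdiff_ssubset hTS ⟨v 0, by simp⟩) (card_pos.1 (by omega))
    omega

end MultipartiteColoring

/-- Every edge-coloring of `K_{n₁,…,n_r}` with exactly `n₁+⋯+n_r + t` colors contains a
rainbow `C₄`, where `t = min{⌊(n₁+⋯+n_r)/3⌋, ⌊(n₂+⋯+n_r)/2⌋, n₃+⋯+n_r}`. -/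
theorem rainbow_C4_of_many_colors (r : ℕ) (n : ℕ → ℕ) (hr : 3 ≤ r)
    (hmono : ∀ i j : ℕ, i ≤ j → j < r → n j ≤ n i)
    (hpos : ∀ i : ℕ, i < r → 1 ≤ n i)
    (c : Sym2 ((i : Fin r) × Fin (n i)) →
      Fin ((∑ i ∈ Finset.range r, n i) +
        min (min ((∑ i ∈ Finset.range r, n i) / 3) ((∑ i ∈ Finset.Ico 1 r, n i) / 2))
          (∑ i ∈ Finset.Ico 2 r, n i)))
    (hc : SurjOnEdges (Kpartite r n) c) :
    RainbowC4 (Kpartite r n) c := by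
  by_contra hno
  let W := (i : Fin r) × Fin (n i)
  let T : ℕ → Finset W → Finset W := fun m A => A.filter fun x => m ≤ x.1.val
  let ν : Finset W → ℕ := fun A => min (min (A.card / 3) ((T 1 A).card / 2)) (T 2 A).card
  have hC4 : NoRainbowC4 (fun x : W => x.1) fun x y => c s(x, y) := by
    intro a b d e h1 h2 h3 h4 h5 h6
    by_contra! h
    obtain ⟨k1, k2, k3, k4, k5, k6⟩ := h
    exact hno ⟨a, b, d, e, h1, h2, h3, h4, h5, h6, k1, k2, k3, k4, k5, k6⟩
  have hadd : ∀ A B, Disjoint A B → ν A + ν B ≤ ν (A ∪ B) := by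
    intro A B hAB
    have hT : ∀ m, (T m (A ∪ B)).card = (T m A).card + (T m B).card := fun m => by
      simp only [T, filter_union]
      exact card_union_of_disjoint (disjoint_filter_filter hAB)
    simp only [ν, hT, card_union_of_disjoint hAB]
    omega
  have htri : ∀ a b d : W, a.1 ≠ b.1 → b.1 ≠ d.1 → d.1 ≠ a.1 → 1 ≤ ν {a, b, d} := by
    intro a b d h1 h2 h3
    have hab : a ≠ b := fun e => h1 (by rw [e])
    have hbd : b ≠ d := fun e => h2 (by rw [e])
    have had : a ≠ d := fun e => h3 (by rw [e])
    have e1 : ∀ m, (T m {a, b, d}).card = (if m ≤ a.1.val then 1 else 0) +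
        ((if m ≤ b.1.val then 1 else 0) + (if m ≤ d.1.val then 1 else 0)) := by
      intro m
      simp only [T, card_filter]
      rw [sum_insert (by simp [hab, had]), sum_insert (by simp [hbd]), sum_singleton]
    have e2 : ({a, b, d} : Finset W).card = 3 := card_eq_three.2 ⟨_, _, _, hab, had, hbd, rfl⟩
    simp only [ν, e1, e2]
    rw [Ne, Fin.ext_iff] at h1 h2 h3
    split_ifs <;> omega
  have hcard : ∀ m, (T m univ).card = ∑ i ∈ Ico m r, n i := by
    intro m
    have e : T m univ = (univ.filter fun i : Fin r => m ≤ i.val).sigma fun _ => univ := by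
      ext ⟨i, j⟩
      refine Iff.trans ?_ mem_sigma.symm
      simp [T]
    rw [e, card_sigma, sum_filter]
    simp only [card_univ, Fintype.card_fin]
    rw [Fin.sum_univ_eq_sum_range (fun i => if m ≤ i then n i else 0) r, ← sum_filter]
    congr 1
    ext i
    simp [and_comm]
  have huniv : (univ : Finset W).card = ∑ i ∈ range r, n i := by
    rw [range_eq_Ico, ← hcard 0]
    simp only [T, Nat.zero_le, filter_true]
  have hsurj : edgeColors (fun x : W => x.1) (fun x y => c s(x, y)) univ = univ := by
    refine eq_univ_of_forall fun i => ?_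
    obtain ⟨e, he, rfl⟩ := hc i
    induction e with
    | _ x y => exact mem_edgeColors.2 ⟨x, mem_univ x, y, mem_univ y, he, rfl⟩
  have hne : (univ : Finset W).Nonempty :=
    ⟨⟨⟨0, by omega⟩, ⟨0, hpos 0 (by omega)⟩⟩, mem_univ _⟩
  have key := card_edgeColors_lt (π := fun x : W => x.1) (f := fun x y => c s(x, y))
    (fun x y => by rw [Sym2.eq_swap]) hC4 hadd htri univ hne
  rw [hsurj, card_univ, Fintype.card_fin] at key
  simp only [ν, hcard, huniv] at key
  omega
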